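/- Let p be a prime, k, r positive integers, G_1, …, G_k finite-dimensional F_p-vector spaces, G⊕ = G_1 ⊕ ⋯ ⊕ G_k, and ξ > 0. Suppose a multilinear form ψ : (G⊕)^{r−1} × G_1 × ⋯ × G_k → F_p and a function f : G⊕ → 𝔻 satisfy condition (★): E_{a^{(1)},…,a^{(r−1)} ∈ G⊕, d_1 ∈ G_1,…,d_k ∈ G_k, x ∈ G⊕} Δ_{a^{(1)}} ⋯ Δ_{a^{(r−1)}} Δ_{d_1} ⋯ Δ_{d_k} f(x) · ω^{ψ(a^{(1)},…,a^{(r−1)},d_1,…,d_k)} ≥ ξ. Then for every i ∈ [r−1] and j ∈ [k], the multilinear form ψ'_{ij} : (G⊕)^{i−1} × G_j × (G⊕)^{r−1−i} × G_1 × ⋯ × G_k → F_p defined by ψ'_{ij}(a^{(1)},…,a^{(i−1)}, u_j, a^{(i+1)},…,a^{(r−1)}, d_1,…,d_k) = ψ(a^{(1)},…,a^{(i−1)}, ι_j(u_j), a^{(i+1)},…,a^{(r−1)}, d_1,…,d_{j−1}, d_j, d_{j+1},…,d_k) − ψ(a^{(1)},…,a^{(i−1)}, ι_j(d_j), a^{(i+1)},…,a^{(r−1)},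 d_1,…,d_{j−1}, u_j, d_{j+1},…,d_k), where ι_j : G_j → G⊕ is the canonical inclusion, satisfies bias ψ'_{ij} ≥ ξ^8. -/

import Mathlib

noncomputable section

namespace DGU

/-- `e^{2πi t/p}` for `t ∈ ℤ/p`. -/
def chi (p : ℕ) (t : ZMod p) : ℂ :=
  Complex.exp (2 * Real.pi * Complex.I * ((t.val : ℂ) / (p : ℂ)))

/-- Average of a complex-valued function over a finite type. -/
def cavg {α : Type*} [Fintype α] (f : α → ℂ) : ℂ :=
  (∑ x, f x) / (Fintype.card α : ℂ)

/-- Average of a real-valued function over a finite type. -/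
def ravg {α : Type*} [Fintype α] (f : α → ℝ) : ℝ :=
  (∑ x, f x) / (Fintype.card α : ℝ)

/-- Multiplicative discrete derivative. -/
def mder {G : Type*} [Add G] (u : G) (f : G → ℂ) : G → ℂ :=
  fun x => f (x + u) * (starRingEnd ℂ) (f x)

/-- Iterated multiplicative discrete derivative along a list of directions. -/
def mderList {G : Type*} [Add G] (l : List G) (f : G → ℂ) : G → ℂ :=
  l.foldr mder f

/-- Additive discrete derivative. -/
def aderiv {G R : Type*} [Add G] [Sub R] (a : G) (F : G → R) : G → R :=
  fun x => F (x + a) - F x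

/-- Iterated additive discrete derivative along a list of directions. -/
def aderivList {G R : Type*} [Add G] [Sub R] (l : List G) (F : G → R) : G → R :=
  l.foldr aderiv F

/-- `t`-fold iterated exponential. -/
def iterExp : ℕ → ℝ → ℝ
  | 0, x => x
  | t + 1, x => Real.exp (iterExp t x)

/-- `P : G → R` is a polynomial of degree at most `d`. -/
def IsPolyDegLE {G R : Type*} [Add G] [Sub R] [Zero R] (d : ℕ) (P : G → R) : Prop :=
  ∀ (a : Fin (d + 1) → G) (x : G), aderivList (List.ofFn a) P x = 0

/-- `n`-fold complex conjugation. -/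
def conjIter (n : ℕ) (z : ℂ) : ℂ := (starRingEnd ℂ)^[n] z

/-- Cubical convolution of a family of functions indexed by subsets of `[k]`. -/
def cubicalConv {k : ℕ} {G : Fin k → Type*} [∀ i, AddCommGroup (G i)] [∀ i, Fintype (G i)]
    (f : Finset (Fin k) → (∀ i, G i) → ℂ) : (∀ i, G i) → ℂ :=
  fun a => cavg (fun x : ∀ i, G i =>
    ∏ I : Finset (Fin k),
      conjIter (k - I.card) (f I (fun i => if i ∈ I then x i + a i else x i)))

/-- A map on a product of `ℤ/p`-vector spaces is multiaffine if it is affine in each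
variable separately. -/
def IsMultiaffine (p : ℕ) {k : ℕ} {G : Fin k → Type*} [∀ i, AddCommGroup (G i)]
    [∀ i, Module (ZMod p) (G i)] {W : Type*} [AddCommGroup W] [Module (ZMod p) W]
    (α : (∀ i, G i) → W) : Prop :=
  ∀ (d : Fin k) (x : ∀ i, G i), ∃ (L : G d →ₗ[ZMod p] W) (c : W),
    ∀ y : G d, α (Function.update x d y) = L y + c

/-- A function `ψ : A^m × G₁ × ⋯ × G_k → ℤ/p` which is linear in each of the `m + k`
variables separately. -/
def MultilinearPair (p m k : ℕ) (A : Type*) [AddCommGroup A] [Module (ZMod p) A]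
    (G : Fin k → Type*) [∀ i, AddCommGroup (G i)] [∀ i, Module (ZMod p) (G i)]
    (ψ : (Fin m → A) → (∀ j, G j) → ZMod p) : Prop :=
  (∀ (i : Fin m) (a : Fin m → A) (d : ∀ j, G j) (u v : A) (s t : ZMod p),
      ψ (Function.update a i (s • u + t • v)) d =
        s * ψ (Function.update a i u) d + t * ψ (Function.update a i v) d) ∧
  (∀ (j : Fin k) (a : Fin m → A) (d : ∀ l, G l) (u v : G j) (s t : ZMod p),
      ψ a (Function.update d j (s • u + t • v)) =
        s * ψ a (Function.update d j u) + t * ψ a (Function.update d j v))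

/-- The `2^k`-th power of the Gowers box norm. -/
def boxPow {k : ℕ} {G : Fin k → Type*} [∀ i, Fintype (G i)] (f : (∀ i, G i) → ℂ) : ℂ :=
  cavg (fun z : (∀ i, G i) × (∀ i, G i) =>
    ∏ I : Finset (Fin k), conjIter I.card (f (fun i => if i ∈ I then z.1 i else z.2 i)))

/-- `μ` belongs to the `ε`-large multilinear spectrum of `f`. -/
def MemMLS (p : ℕ) {k : ℕ} {G : Fin k → Type*} [∀ i, Fintype (G i)] [∀ i, AddCommGroup (G i)]
    [∀ i, Module (ZMod p) (G i)] (ε : ℝ) (f : (∀ i, G i) → ℂ)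
    (μ : MultilinearMap (ZMod p) G (ZMod p)) : Prop :=
  ε ^ 2 ^ k ≤ (boxPow (fun x => f x * chi p (μ x))).re

theorem chi_eq_stdAddChar (p : ℕ) [NeZero p] (t : ZMod p) : chi p t = ZMod.stdAddChar t := by
  have h := ZMod.stdAddChar_coe (N := p) (t.val : ℤ)
  simp only [Int.cast_natCast, ZMod.natCast_zmod_val] at h
  rw [h, chi]
  congr 1
  ring

section Derivative

variable {G : Type*} [AddCommGroup G]

theorem norm_mder_le_one {f : G → ℂ} (hf : ∀ x, ‖f x‖ ≤ 1) (u x : G) : ‖mder u f x‖ ≤ 1 := by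
  simpa [mder] using mul_le_one₀ (hf _) (norm_nonneg _) (hf x)

theorem norm_mderList_le_one {f : G → ℂ} (hf : ∀ x, ‖f x‖ ≤ 1) (l : List G) (x : G) :
    ‖mderList l f x‖ ≤ 1 := by
  induction l generalizing x with
  | nil => exact hf x
  | cons u l ih => exact norm_mder_le_one ih u x

theorem mder_comm (u v : G) (f : G → ℂ) : mder u (mder v f) = mder v (mder u f) := by
  funext x
  simp only [mder, map_mul, Complex.conj_conj, add_right_comm x u v]
  ring

theorem mderList_perm {l₁ l₂ : List G} (h : l₁.Perm l₂) (f : G → ℂ) :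
    mderList l₁ f = mderList l₂ f :=
  have : LeftCommutative (mder : G → (G → ℂ) → G → ℂ) := ⟨mder_comm⟩
  h.foldr_eq f

end Derivative

theorem ofFn_perm_cons {α : Type*} {n : ℕ} (g : Fin n → α) (i : Fin n) :
    (List.ofFn g).Perm (g i :: ((List.finRange n).erase i).map g) := by
  rw [List.ofFn_eq_map]
  exact (List.perm_cons_erase (List.mem_finRange i)).map g

theorem map_erase_finRange_congr {α : Type*} {n : ℕ} {g g' : Fin n → α} {i : Fin n}
    (h : ∀ l, l ≠ i → g l = g' l) :
    ((List.finRange n).erase i).map g = ((List.finRange n).erase i).map g' :=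
  List.map_congr_left fun l hl => h l ((List.nodup_finRange n).mem_erase_iff.1 hl).1

/-- A sum of the phase of a biadditive map against bounded functions of one variable each is
controlled by the sum of the phase alone. -/
theorem norm_sum_mul_addChar_sq_le {H R : Type*} [AddCommGroup H] [Fintype H] [AddCommGroup R]
    [Finite R] (e : AddChar R ℂ) (q : H → H → R)
    (hq₁ : ∀ s s' t, q (s + s') t = q s t + q s' t)
    (hq₂ : ∀ s t t', q s (t + t') = q s t + q s t')
    (A B : H → ℂ) (hA : ∀ s, ‖A s‖ ≤ 1) (hB : ∀ t, ‖B t‖ ≤ 1) :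
    ‖∑ s, ∑ t, A s * B t * e (q s t)‖ ^ 2 ≤
      (Fintype.card H : ℝ) ^ 2 * (∑ s, ∑ t, e (q s t)).re := by
  classical
  have hnn (t : H) : (‖∑ s, e (q s t)‖ : ℝ) = (∑ s, e (q s t)).re := by
    let χ : AddChar H ℂ := e.compAddMonoidHom (AddMonoidHom.mk' (q · t) fun s s' => hq₁ s s' t)
    have h : ∑ s, e (q s t) = ∑ s, χ s := rfl
    rw [h, AddChar.sum_eq_ite]
    split_ifs <;> simp
  have hq_sub (s t t' : H) : q s (t - t') = q s t - q s t' := by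
    rw [eq_sub_iff_add_eq, ← hq₂, sub_add_cancel]
  have hsq (s : H) : ((‖∑ t, B t * e (q s t)‖ ^ 2 : ℝ) : ℂ) =
      ∑ t, ∑ t', B t * (starRingEnd ℂ) (B t') * e (q s (t - t')) := by
    push_cast
    rw [← Complex.mul_conj', map_sum, Finset.sum_mul_sum]
    refine Finset.sum_congr rfl fun t _ => Finset.sum_congr rfl fun t' _ => ?_
    rw [hq_sub, sub_eq_add_neg, AddChar.map_add_eq_mul, AddChar.map_neg_eq_conj, map_mul]
    ring
  have hcs : ‖∑ s, ∑ t, A s * B t * e (q s t)‖ ^ 2 ≤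
      (Fintype.card H : ℝ) * ∑ s, ‖∑ t, B t * e (q s t)‖ ^ 2 := by
    have h : ‖∑ s, ∑ t, A s * B t * e (q s t)‖ ≤ ∑ s, ‖∑ t, B t * e (q s t)‖ := by
      refine (norm_sum_le _ _).trans (Finset.sum_le_sum fun s _ => ?_)
      simp_rw [mul_assoc, ← Finset.mul_sum]
      rw [norm_mul]
      exact mul_le_of_le_one_left (norm_nonneg _) (hA s)
    refine (pow_le_pow_left₀ (norm_nonneg _) h 2).trans ?_
    simpa using sq_sum_le_card_mul_sum_sq (s := Finset.univ)
      (f := fun s => ‖∑ t, B t * e (q s t)‖)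
  have hmain : ∑ s, ‖∑ t, B t * e (q s t)‖ ^ 2 ≤
      (Fintype.card H : ℝ) * (∑ s, ∑ t, e (q s t)).re := by
    have hswap : ((∑ s, ‖∑ t, B t * e (q s t)‖ ^ 2 : ℝ) : ℂ) =
        ∑ t, ∑ t', B t * (starRingEnd ℂ) (B t') * ∑ s, e (q s (t - t')) := by
      rw [Complex.ofReal_sum, Finset.sum_congr rfl fun s _ => hsq s, Finset.sum_comm]
      refine Finset.sum_congr rfl fun t _ => ?_
      rw [Finset.sum_comm]
      simp_rw [Finset.mul_sum]
    have hpos : 0 ≤ ∑ s, ‖∑ t, B t * e (q s t)‖ ^ 2 :=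
      Finset.sum_nonneg fun _ _ => sq_nonneg _
    calc ∑ s, ‖∑ t, B t * e (q s t)‖ ^ 2
        = ‖((∑ s, ‖∑ t, B t * e (q s t)‖ ^ 2 : ℝ) : ℂ)‖ := by
          rw [Complex.norm_real, Real.norm_of_nonneg hpos]
      _ ≤ ∑ t, ∑ t', ‖∑ s, e (q s (t - t'))‖ := by
          rw [hswap]
          refine (norm_sum_le _ _).trans (Finset.sum_le_sum fun t _ => ?_)
          refine (norm_sum_le _ _).trans (Finset.sum_le_sum fun t' _ => ?_)
          rw [norm_mul]
          refine mul_le_of_le_one_left (norm_nonneg _) ?_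
          simpa using mul_le_one₀ (hB t) (norm_nonneg _) (hB t')
      _ = ∑ _t : H, ∑ t', ‖∑ s, e (q s t')‖ :=
          Finset.sum_congr rfl fun t _ =>
            Equiv.sum_comp (Equiv.subLeft t) fun t' => ‖∑ s, e (q s t')‖
      _ = (Fintype.card H : ℝ) * (∑ s, ∑ t, e (q s t)).re := by
          rw [Finset.sum_comm (f := fun s t => e (q s t)), Complex.re_sum]
          simp [hnn]
  calc _ ≤ _ := hcs
    _ ≤ (Fintype.card H : ℝ) * ((Fintype.card H : ℝ) * (∑ s, ∑ t, e (q s t)).re) := by gcongr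
    _ = _ := by ring

theorem sum_add_right {Z M : Type*} [AddGroup Z] [Fintype Z] [AddCommMonoid M] (g : Z → M)
    (c : Z) : ∑ z, g (z + c) = ∑ z, g z :=
  Equiv.sum_comp (Equiv.addRight c) g

/-- Averaging over translates: if, around every point, the average of `T` over a family of
translates is controlled by `Q`, then so is the global sum. -/
theorem norm_sum_sq_le_of_translates {Z H : Type*} [AddCommGroup Z] [Fintype Z] [Fintype H]
    [Nonempty H] (T : Z → ℂ) (c : H → H → Z) (Q : Z → ℝ)
    (h : ∀ z, ‖∑ s, ∑ t, T (z + c s t)‖ ^ 2 ≤ (Fintype.card H : ℝ) ^ 2 * Q z) :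
    (Fintype.card H : ℝ) ^ 2 * ‖∑ z, T z‖ ^ 2 ≤ Fintype.card Z * ∑ z, Q z := by
  have hH : (0 : ℝ) < Fintype.card H := by exact_mod_cast Fintype.card_pos
  have hsum : ∑ z, ∑ s, ∑ t, T (z + c s t) = (Fintype.card H : ℂ) ^ 2 * ∑ z, T z := by
    rw [Finset.sum_comm]
    have hs (s : H) : ∑ z, ∑ t, T (z + c s t) = Fintype.card H * ∑ z, T z := by
      rw [Finset.sum_comm]
      simp [sum_add_right T]
    simp [hs, sq, mul_assoc]
  have hle : ((Fintype.card H : ℝ) ^ 2 * ‖∑ z, T z‖) ^ 2 ≤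
      Fintype.card Z * ∑ z, (Fintype.card H : ℝ) ^ 2 * Q z := by
    have h₁ : (Fintype.card H : ℝ) ^ 2 * ‖∑ z, T z‖ ≤ ∑ z, ‖∑ s, ∑ t, T (z + c s t)‖ := by
      refine le_trans (le_of_eq ?_) (norm_sum_le _ _)
      rw [hsum]
      simp
    refine (pow_le_pow_left₀ (by positivity) h₁ 2).trans ?_
    refine (sq_sum_le_card_mul_sum_sq (s := Finset.univ)).trans ?_
    rw [Finset.card_univ]
    gcongr with z
    exact h z
  rw [← Finset.mul_sum] at hle
  refine le_of_mul_le_mul_left ?_ (pow_pos hH 2)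
  linarith [hle]

/-- Resampling one coordinate does not change a sum, up to normalization. -/
theorem sum_sum_update {ι M : Type*} [Fintype ι] [DecidableEq ι] {G : ι → Type*}
    [∀ i, AddCommGroup (G i)] [∀ i, Fintype (G i)] [AddCommMonoid M]
    (g : (∀ i, G i) → M) (j : ι) :
    ∑ d, ∑ v, g (Function.update d j v) = Fintype.card (G j) • ∑ d, g d := by
  have h (d : ∀ i, G i) : ∑ v, g (Function.update d j v) = ∑ v, g (d + Pi.single j v) := by
    rw [← Equiv.sum_comp (Equiv.addLeft (d j))]
    refine Finset.sum_congr rfl fun v _ => congrArg g ?_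
    ext l
    by_cases hl : l = j
    · subst hl; simp
    · simp [hl]
  rw [Finset.sum_congr rfl fun d _ => h d, Finset.sum_comm]
  simp [sum_add_right g]

theorem update_add_single {ι : Type*} [DecidableEq ι] {G : ι → Type*}
    [∀ i, AddCommGroup (G i)] (a : ∀ i, G i) (i : ι) (u : G i) :
    a + Pi.single i u = Function.update a i (a i + u) := by
  ext l
  by_cases hl : l = i
  · subst hl; simp
  · simp [hl]

/-- The form exchanging the `j`-th component of the `i`-th argument with the direction `d j`. -/
def exchange {p m k : ℕ} {G : Fin k → Type*} [∀ i, AddCommGroup (G i)]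
    (ψ : (Fin m → ∀ i, G i) → (∀ j, G j) → ZMod p) (i : Fin m) (j : Fin k)
    (a : Fin m → ∀ i, G i) (d : ∀ j, G j) (s t : G j) : ZMod p :=
  ψ (Function.update a i (Pi.single j s)) (Function.update d j t) -
    ψ (Function.update a i (Pi.single j t)) (Function.update d j s)

section MultilinearPair

variable {p m k : ℕ} {G : Fin k → Type*} [∀ i, AddCommGroup (G i)] [∀ i, Module (ZMod p) (G i)]

theorem MultilinearPair.update_left_add {A : Type*} [AddCommGroup A] [Module (ZMod p) A]
    {ψ : (Fin m → A) → (∀ j, G j) → ZMod p} (hψ : MultilinearPair p m k A G ψ)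
    (i : Fin m) (a : Fin m → A) (d : ∀ j, G j) (u v : A) :
    ψ (Function.update a i (u + v)) d =
      ψ (Function.update a i u) d + ψ (Function.update a i v) d := by
  simpa using hψ.1 i a d u v 1 1

theorem MultilinearPair.update_right_add {A : Type*} [AddCommGroup A] [Module (ZMod p) A]
    {ψ : (Fin m → A) → (∀ j, G j) → ZMod p} (hψ : MultilinearPair p m k A G ψ)
    (j : Fin k) (a : Fin m → A) (d : ∀ l, G l) (u v : G j) :
    ψ a (Function.update d j (u + v)) =
      ψ a (Function.update d j u) + ψ a (Function.update d j v) := by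
  simpa using hψ.2 j a d u v 1 1

theorem MultilinearPair.update_left_sub {A : Type*} [AddCommGroup A] [Module (ZMod p) A]
    {ψ : (Fin m → A) → (∀ j, G j) → ZMod p} (hψ : MultilinearPair p m k A G ψ)
    (i : Fin m) (a : Fin m → A) (d : ∀ j, G j) (u v : A) :
    ψ (Function.update a i (u - v)) d =
      ψ (Function.update a i u) d - ψ (Function.update a i v) d := by
  rw [eq_sub_iff_add_eq, ← hψ.update_left_add, sub_add_cancel]

theorem MultilinearPair.update_right_sub {A : Type*} [AddCommGroup A] [Module (ZMod p) A]
    {ψ : (Fin m → A) → (∀ j, G j) → ZMod p} (hψ : MultilinearPair p m k A G ψ)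
    (j : Fin k) (a : Fin m → A) (d : ∀ l, G l) (u v : G j) :
    ψ a (Function.update d j (u - v)) =
      ψ a (Function.update d j u) - ψ a (Function.update d j v) := by
  rw [eq_sub_iff_add_eq, ← hψ.update_right_add, sub_add_cancel]

variable {ψ : (Fin m → ∀ i, G i) → (∀ j, G j) → ZMod p}

theorem MultilinearPair.exchange_add_left (hψ : MultilinearPair p m k (∀ i, G i) G ψ)
    (i : Fin m) (j : Fin k) (a : Fin m → ∀ i, G i) (d : ∀ j, G j) (s s' t : G j) :
    exchange ψ i j a d (s + s') t = exchange ψ i j a d s t + exchange ψ i j a d s' t := by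
  simp only [exchange, Pi.single_add, hψ.update_left_add, hψ.update_right_add]
  ring

theorem MultilinearPair.exchange_add_right (hψ : MultilinearPair p m k (∀ i, G i) G ψ)
    (i : Fin m) (j : Fin k) (a : Fin m → ∀ i, G i) (d : ∀ j, G j) (s t t' : G j) :
    exchange ψ i j a d s (t + t') = exchange ψ i j a d s t + exchange ψ i j a d s t' := by
  simp only [exchange, Pi.single_add, hψ.update_left_add, hψ.update_right_add]
  ring

/-- Along suitable translates, the phase is the exchange form plus functions of one variable. -/
theorem MultilinearPair.apply_translate (hψ : MultilinearPair p m k (∀ i, G i) G ψ)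
    (i : Fin m) (j : Fin k) (a : Fin m → ∀ i, G i) (d : ∀ j, G j) :
    ∃ P Q : G j → ZMod p, ∀ s t,
      ψ (a + Pi.single i (Pi.single j (t - s))) (d + Pi.single j (-s - t)) =
        P s + Q t + exchange ψ i j a d s t := by
  let β (A : ∀ i, G i) (D : G j) := ψ (Function.update a i A) (Function.update d j D)
  refine ⟨fun s => β (a i) (d j) - β (a i) s - β (Pi.single j s) (d j) + β (Pi.single j s) s,
    fun t => β (Pi.single j t) (d j) - β (a i) t - β (Pi.single j t) t, fun s t => ?_⟩
  have hd : d j + (-s - t) = d j - s - t := by abel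
  rw [update_add_single a, update_add_single d, hd]
  simp only [β, exchange, Pi.single_sub, hψ.update_left_add, hψ.update_left_sub,
    hψ.update_right_sub]
  ring

end MultilinearPair

/-- Isolating two directions in the iterated derivative: the others are collected in a bounded
function `F` which does not change with the two isolated directions. -/
theorem exists_mderList_translate {m k : ℕ} {G : Fin k → Type*} [∀ i, AddCommGroup (G i)]
    {f : (∀ i, G i) → ℂ} (hf : ∀ x, ‖f x‖ ≤ 1) (i : Fin m) (j : Fin k)
    (a : Fin m → ∀ i, G i) (d : ∀ j, G j) :
    ∃ F : (∀ i, G i) → ℂ, (∀ x, ‖F x‖ ≤ 1) ∧ ∀ (u : ∀ i, G i) (v : G j),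
      mderList (List.ofFn (a + Pi.single i u) ++
          List.ofFn fun l : Fin k => Pi.single l ((d + Pi.single j v : ∀ l, G l) l)) f =
        mder (a i + u) (mder (Pi.single j (d j + v)) F) := by
  refine ⟨mderList (((List.finRange m).erase i).map a ++
    ((List.finRange k).erase j).map fun l => Pi.single l (d l)) f,
    norm_mderList_le_one hf _, fun u v => ?_⟩
  have h₁ := ofFn_perm_cons (a + Pi.single i u) i
  have h₂ := ofFn_perm_cons
    (fun l : Fin k => (Pi.single l ((d + Pi.single j v : ∀ l, G l) l) : ∀ l, G l)) j
  rw [map_erase_finRange_congr (g' := a) fun l hl => by simp [hl]] at h₁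
  rw [map_erase_finRange_congr (g' := fun l => Pi.single l (d l)) fun l hl => by simp [hl]] at h₂
  rw [mderList_perm ((h₁.append h₂).trans (List.perm_middle.cons _))]
  simp [mderList]

/-- Proposition 11, Symmetry II: if the phase of a multilinear form `ψ`
correlates with the iterated derivative of `f` (condition (★)), then for any `i ∈ [r-1]` and
`j ∈ [k]` the form `ψ'_{ij}`, obtained by exchanging the `j`-th component of the `i`-th
`a`-argument with the direction `d_j`, has bias at least `ξ^8`. -/
theorem symmetry_argument_II
    (p k r : ℕ) (hp : p.Prime) (hk : 0 < k) (hr : 0 < r)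
    (G : Fin k → Type) [∀ i, AddCommGroup (G i)] [∀ i, Module (ZMod p) (G i)]
    [∀ i, Fintype (G i)]
    (ψ : (Fin (r - 1) → ∀ i, G i) → (∀ j, G j) → ZMod p)
    (hψ : MultilinearPair p (r - 1) k (∀ i, G i) G ψ)
    (f : (∀ i, G i) → ℂ) (hf : ∀ x, ‖f x‖ ≤ 1) (ξ : ℝ) (hξ : 0 < ξ)
    (hstar : ξ ≤
      (cavg (fun z : (Fin (r - 1) → ∀ i, G i) × (∀ i, G i) × (∀ i, G i) =>
        mderList (List.ofFn z.1 ++ List.ofFn fun i : Fin k => Pi.single i (z.2.1 i)) f z.2.2 *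
          chi p (ψ z.1 z.2.1))).re) :
    ∀ (i : Fin (r - 1)) (j : Fin k),
      ξ ^ 8 ≤
        (cavg (fun z : (Fin (r - 1) → ∀ i, G i) × G j × (∀ l, G l) =>
          chi p (ψ (Function.update z.1 i (Pi.single j z.2.1)) z.2.2 -
            ψ (Function.update z.1 i (Pi.single j (z.2.2 j)))
              (Function.update z.2.2 j z.2.1)))).re := by
  intro i j
  have : NeZero p := ⟨hp.ne_zero⟩
  simp only [chi_eq_stdAddChar] at hstar ⊢
  set T : (Fin (r - 1) → ∀ i, G i) × (∀ i, G i) × (∀ i, G i) → ℂ := fun z =>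
    mderList (List.ofFn z.1 ++ List.ofFn fun i : Fin k => Pi.single i (z.2.1 i)) f z.2.2 *
      ZMod.stdAddChar (ψ z.1 z.2.1) with hT
  set S : (Fin (r - 1) → ∀ i, G i) × G j × (∀ l, G l) → ℂ := fun z =>
    ZMod.stdAddChar (ψ (Function.update z.1 i (Pi.single j z.2.1)) z.2.2 -
      ψ (Function.update z.1 i (Pi.single j (z.2.2 j))) (Function.update z.2.2 j z.2.1)) with hS
  have hlocal := norm_sum_sq_le_of_translates T
    (fun s t : G j =>
      (Pi.single i (Pi.single j (t - s)), Pi.single j (-s - t), Pi.single j s))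
    (fun z => (∑ s, ∑ t, ZMod.stdAddChar (exchange ψ i j z.1 z.2.1 s t)).re) (by
      rintro ⟨a, d, x⟩
      obtain ⟨F, hF, hder⟩ := exists_mderList_translate hf i j a d
      obtain ⟨P, Q, hPQ⟩ := hψ.apply_translate i j a d
      refine le_trans (le_of_eq ?_) (norm_sum_mul_addChar_sq_le ZMod.stdAddChar
        (exchange ψ i j a d) (hψ.exchange_add_left i j a d) (hψ.exchange_add_right i j a d)
        (fun s => F (x + a i + Pi.single j (d j - s)) * F (x + Pi.single j s) *
          ZMod.stdAddChar (P s))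
        (fun t => (starRingEnd ℂ) (F (x + a i + Pi.single j t)) *
          (starRingEnd ℂ) (F (x + Pi.single j (d j - t))) * ZMod.stdAddChar (Q t)) ?_ ?_)
      · congr 2
        refine Finset.sum_congr rfl fun s _ => Finset.sum_congr rfl fun t _ => ?_
        simp only [hT, Prod.mk_add_mk]
        rw [hder, hPQ, AddChar.map_add_eq_mul, AddChar.map_add_eq_mul]
        have e₁ : x + Pi.single j s + (a i + Pi.single j (t - s)) + Pi.single j (d j + (-s - t)) =
            x + a i + Pi.single j (d j - s) := by
          simp only [Pi.single_add, Pi.single_sub, Pi.single_neg]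
          abel
        have e₂ : x + Pi.single j s + (a i + Pi.single j (t - s)) = x + a i + Pi.single j t := by
          simp only [Pi.single_sub]
          abel
        have e₃ : x + Pi.single j s + Pi.single j (d j + (-s - t)) =
            x + Pi.single j (d j - t) := by
          simp only [Pi.single_add, Pi.single_sub, Pi.single_neg]
          abel
        simp only [mder, e₁, map_mul, Complex.conj_conj, e₃]
        rw [e₂]
        ring
      · intro s
        simpa using mul_le_one₀ (hF _) (norm_nonneg _) (hF _)
      · intro t
        simpa using mul_le_one₀ (hF _) (norm_nonneg _) (hF _))
  have hglobal : ∑ z : (Fin (r - 1) → ∀ i, G i) × (∀ i, G i) × (∀ i, G i),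
      ∑ s, ∑ t, (ZMod.stdAddChar (exchange ψ i j z.1 z.2.1 s t) : ℂ) =
        Fintype.card (∀ i, G i) * Fintype.card (G j) * ∑ z, S z := by
    have hinner (a : Fin (r - 1) → ∀ i, G i) :
        ∑ d : ∀ i, G i, ∑ s, ∑ t, (ZMod.stdAddChar (exchange ψ i j a d s t) : ℂ) =
          Fintype.card (G j) * ∑ s, ∑ d, S (a, s, d) := by
      rw [Finset.sum_comm, Finset.mul_sum]
      refine Finset.sum_congr rfl fun s _ => ?_
      rw [← nsmul_eq_mul, ← sum_sum_update]
      simp [hS, exchange]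
    simp only [Fintype.sum_prod_type, Finset.sum_const, Finset.card_univ, nsmul_eq_mul]
    simp only [← Finset.mul_sum, hinner]
    ring
  have hre : ∑ z : (Fin (r - 1) → ∀ i, G i) × (∀ i, G i) × (∀ i, G i),
      (∑ s, ∑ t, (ZMod.stdAddChar (exchange ψ i j z.1 z.2.1 s t) : ℂ)).re =
        Fintype.card (∀ i, G i) * Fintype.card (G j) * (∑ z, S z).re := by
    rw [← Complex.re_sum, hglobal]
    simp [← Nat.cast_mul, -Fintype.card_pi]
  rw [hre] at hlocal
  have hD : (0 : ℝ) < Fintype.card (∀ i, G i) := by exact_mod_cast Fintype.card_pos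
  have hH : (0 : ℝ) < Fintype.card (G j) := by exact_mod_cast Fintype.card_pos
  have hA : (0 : ℝ) < Fintype.card (Fin (r - 1) → ∀ i, G i) := by
    exact_mod_cast Fintype.card_pos
  have hS_re : (cavg S).re = (∑ z, S z).re / (Fintype.card (Fin (r - 1) → ∀ i, G i) *
      (Fintype.card (G j) * Fintype.card (∀ i, G i))) := by
    rw [cavg, Complex.div_natCast_re, Fintype.card_prod, Fintype.card_prod]
    push_cast
    rfl
  have hT_norm : ‖cavg T‖ = ‖∑ z, T z‖ / (Fintype.card (Fin (r - 1) → ∀ i, G i) *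
      (Fintype.card (∀ i, G i) * Fintype.card (∀ i, G i))) := by
    rw [cavg, norm_div, Complex.norm_natCast, Fintype.card_prod, Fintype.card_prod]
    push_cast
    rfl
  rw [Fintype.card_prod, Fintype.card_prod, Nat.cast_mul, Nat.cast_mul] at hlocal
  have hsq : ξ ^ 2 ≤ (cavg S).re := by
    refine (pow_le_pow_left₀ hξ.le (hstar.trans (Complex.re_le_norm _)) 2).trans ?_
    rw [hS_re, hT_norm, div_pow, div_le_div_iff₀ (by positivity) (by positivity)]
    refine le_of_mul_le_mul_left ?_ hH
    generalize (Fintype.card (∀ i, G i) : ℝ) = D at *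
    generalize (Fintype.card (Fin (r - 1) → ∀ i, G i) : ℝ) = A at *
    generalize (Fintype.card (G j) : ℝ) = h at *
    calc _ = A * D * (h ^ 2 * ‖∑ z, T z‖ ^ 2) := by ring
      _ ≤ A * D * (A * (D * D) * (D * h * (∑ z, S z).re)) := by gcongr
      _ = _ := by ring
  have hξ_one : ξ ≤ 1 := by
    have hS_le : (∑ z, S z).re ≤ Fintype.card (Fin (r - 1) → ∀ i, G i) *
        (Fintype.card (G j) * Fintype.card (∀ i, G i)) := by
      refine (Complex.re_le_norm _).trans ((norm_sum_le _ _).trans ?_)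
      simp [hS, Fintype.card_prod, -Fintype.card_pi]
    have : (cavg S).re ≤ 1 := by
      rw [hS_re]
      exact div_le_one_of_le₀ hS_le (by positivity)
    nlinarith
  exact (pow_le_pow_of_le_one hξ.le hξ_one (by norm_num)).trans hsq

end DGU
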